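/- The plane sextic C defined by X⁶ + Y⁶ + XZ⁵ = 0 is smooth over K, and its automorphism group Aut(C) ⊂ PGL₃(K) is cyclic of order 30, generated by diag(1, ζ₃₀⁵, ζ₃₀⁶). -/

import Mathlib

open MvPolynomial

/-- `GL₃(K)`: the group of invertible `3 × 3` matrices over `K`. -/
abbrev GL3 (K : Type*) [Field K] := (Matrix (Fin 3) (Fin 3) K)ˣ

/-- `PGL₃(K)`: the quotient of `GL₃(K)` by its center (the scalar matrices). -/
abbrev PGL3 (K : Type*) [Field K] := GL3 K ⧸ Subgroup.center (GL3 K)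

variable {K : Type*} [Field K]

/-- The substitution `F(X,Y,Z) ↦ F(A·(X,Y,Z)ᵗ)` for a `3 × 3` matrix `A`. -/
noncomputable def matAct (A : Matrix (Fin 3) (Fin 3) K) (F : MvPolynomial (Fin 3) K) :
    MvPolynomial (Fin 3) K :=
  aeval (fun i => ∑ j, C (A i j) * X j) F

lemma matAct_one (F : MvPolynomial (Fin 3) K) : matAct 1 F = F := by
  unfold matAct
  have h : (fun i => ∑ j, C ((1 : Matrix (Fin 3) (Fin 3) K) i j) * X j)
      = (X : Fin 3 → MvPolynomial (Fin 3) K) := by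
    funext i
    rw [Finset.sum_eq_single i]
    · simp
    · intro b _ hb
      simp [Matrix.one_apply, Ne.symm hb]
    · simp
  rw [h, aeval_X_left_apply]

lemma matAct_matAct (A B : Matrix (Fin 3) (Fin 3) K) (F : MvPolynomial (Fin 3) K) :
    matAct B (matAct A F) = matAct (A * B) F := by
  unfold matAct
  rw [← AlgHom.comp_apply, comp_aeval]
  have h : (fun i => (aeval fun i => ∑ j, C (B i j) * X j) (∑ j, C (A i j) * X j))
      = fun i => ∑ j : Fin 3, C ((A * B) i j) * (X j : MvPolynomial (Fin 3) K) := by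
    funext i
    simp only [map_sum, map_mul, aeval_C, aeval_X, algebraMap_eq, Finset.mul_sum]
    rw [Finset.sum_comm]
    refine Finset.sum_congr rfl fun k _ => ?_
    rw [Matrix.mul_apply, map_sum, Finset.sum_mul]
    refine Finset.sum_congr rfl fun j _ => ?_
    rw [map_mul, mul_assoc]
  rw [h]

lemma matAct_smul (A : Matrix (Fin 3) (Fin 3) K) (c : K) (F : MvPolynomial (Fin 3) K) :
    matAct A (c • F) = c • matAct A F :=
  map_smul (aeval fun i => ∑ j, C (A i j) * X j) c F

/-- The class of a matrix `A` in `PGL₃(K)` (junk value `1` if `A` is not invertible). -/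
noncomputable def pgl (A : Matrix (Fin 3) (Fin 3) K) : PGL3 K := by
  classical
  exact if h : IsUnit A then (QuotientGroup.mk h.unit : PGL3 K) else 1

/-- `F` defines a smooth plane sextic: `F` is homogeneous of degree `6`, and `F` together with
its partial derivatives have no common zero besides the origin. -/
def IsSmoothSextic (F : MvPolynomial (Fin 3) K) : Prop :=
  F.IsHomogeneous 6 ∧
    ∀ p : Fin 3 → K, eval p F = 0 → (∀ i, eval p (pderiv i F) = 0) → p = 0

/-- The automorphism group of the plane curve `F = 0`: the subgroup of `PGL₃(K)` consisting of
the classes of matrices `A ∈ GL₃(K)` with `F(A·(X,Y,Z)ᵗ) = λ·F(X,Y,Z)` for some `λ ∈ K×`. -/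
noncomputable def planeAut (F : MvPolynomial (Fin 3) K) : Subgroup (PGL3 K) where
  carrier := {g | ∃ A : GL3 K, (QuotientGroup.mk A : PGL3 K) = g ∧
    ∃ c : K, c ≠ 0 ∧ matAct (A : Matrix (Fin 3) (Fin 3) K) F = c • F}
  one_mem' := ⟨1, rfl, 1, one_ne_zero, by rw [Units.val_one, matAct_one, one_smul]⟩
  mul_mem' := by
    rintro g h ⟨A, rfl, c, hc, hA⟩ ⟨B, rfl, d, hd, hB⟩
    exact ⟨A * B, rfl, c * d, mul_ne_zero hc hd, by
      rw [Units.val_mul, ← matAct_matAct, hA, matAct_smul, hB, smul_smul]⟩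
  inv_mem' := by
    rintro g ⟨A, rfl, c, hc, hA⟩
    refine ⟨A⁻¹, rfl, c⁻¹, inv_ne_zero hc, ?_⟩
    rw [eq_inv_smul_iff₀ hc, ← matAct_smul, ← hA, matAct_matAct, ← Units.val_mul,
      mul_inv_cancel, Units.val_one, matAct_one]

section Coefficients

variable {L : Type*} [Field L] [CharZero L]

lemma coeffs_eq_zero_of_forall_eq_zero {c₀ c₁ c₂ c₃ c₄ c₅ c₆ : L}
    (h : ∀ t : L, c₀ + c₁ * t + c₂ * t ^ 2 + c₃ * t ^ 3 + c₄ * t ^ 4 + c₅ * t ^ 5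
      + c₆ * t ^ 6 = 0) :
    c₀ = 0 ∧ c₁ = 0 ∧ c₂ = 0 ∧ c₃ = 0 ∧ c₄ = 0 ∧ c₅ = 0 ∧ c₆ = 0 := by
  have hp : (Polynomial.C c₀ + Polynomial.C c₁ * Polynomial.X + Polynomial.C c₂ * Polynomial.X ^ 2
      + Polynomial.C c₃ * Polynomial.X ^ 3 + Polynomial.C c₄ * Polynomial.X ^ 4
      + Polynomial.C c₅ * Polynomial.X ^ 5 + Polynomial.C c₆ * Polynomial.X ^ 6 :
      Polynomial L) = 0 := by
    refine Polynomial.funext fun t => ?_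
    simpa using h t
  have key (n : ℕ) := congrArg (fun p => Polynomial.coeff p n) hp
  refine ⟨?_, ?_, ?_, ?_, ?_, ?_, ?_⟩
  · simpa [Polynomial.coeff_X, Polynomial.coeff_X_pow, Polynomial.coeff_C] using key 0
  · simpa [Polynomial.coeff_X, Polynomial.coeff_X_pow, Polynomial.coeff_C] using key 1
  · simpa [Polynomial.coeff_X, Polynomial.coeff_X_pow, Polynomial.coeff_C] using key 2
  · simpa [Polynomial.coeff_X, Polynomial.coeff_X_pow, Polynomial.coeff_C] using key 3
  · simpa [Polynomial.coeff_X, Polynomial.coeff_X_pow, Polynomial.coeff_C] using key 4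
  · simpa [Polynomial.coeff_X, Polynomial.coeff_X_pow, Polynomial.coeff_C] using key 5
  · simpa [Polynomial.coeff_X, Polynomial.coeff_X_pow, Polynomial.coeff_C] using key 6

/-- If the derivative of `X⁶ + Y⁶ + XZ⁵` in the direction `(a, b, d)` is the fifth power of a
linear form, up to a nonzero factor, then either `(a, b, d) = 0` or the linear form is a multiple
of `Y` and `a = d = 0`. -/
lemma direction_eq_of_derivative_eq_fifth_power {a b d c p q r : L} (hc : c ≠ 0)
    (hv : ¬(a = 0 ∧ b = 0 ∧ d = 0))
    (h : ∀ x y z : L, 6 * x ^ 5 * a + 6 * y ^ 5 * b + (a * z ^ 5 + x * (5 * z ^ 4 * d))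
      = c * (6 * (p * x + q * y + r * z) ^ 5)) :
    a = 0 ∧ d = 0 ∧ p = 0 ∧ r = 0 := by
  obtain ⟨-, hpq, -, -, -, hbq, -⟩ := coeffs_eq_zero_of_forall_eq_zero
    (c₀ := 6 * a - 6 * c * p ^ 5) (c₁ := -(30 * c * p ^ 4 * q)) (c₂ := -(60 * c * p ^ 3 * q ^ 2))
    (c₃ := -(60 * c * p ^ 2 * q ^ 3)) (c₄ := -(30 * c * p * q ^ 4)) (c₅ := 6 * b - 6 * c * q ^ 5)
    (c₆ := 0) fun t => by linear_combination h 1 t 0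
  obtain ⟨-, hrq, -, -, -, -, -⟩ := coeffs_eq_zero_of_forall_eq_zero
    (c₀ := a - 6 * c * r ^ 5) (c₁ := -(30 * c * r ^ 4 * q)) (c₂ := -(60 * c * r ^ 3 * q ^ 2))
    (c₃ := -(60 * c * r ^ 2 * q ^ 3)) (c₄ := -(30 * c * r * q ^ 4)) (c₅ := 6 * b - 6 * c * q ^ 5)
    (c₆ := 0) fun t => by linear_combination h 0 t 1
  obtain ⟨har, hd, -, -, hpr, hap, -⟩ := coeffs_eq_zero_of_forall_eq_zero
    (c₀ := a - 6 * c * r ^ 5) (c₁ := 5 * d - 30 * c * p * r ^ 4)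
    (c₂ := -(60 * c * p ^ 2 * r ^ 3)) (c₃ := -(60 * c * p ^ 3 * r ^ 2))
    (c₄ := -(30 * c * p ^ 4 * r)) (c₅ := 6 * a - 6 * c * p ^ 5)
    (c₆ := 0) fun t => by linear_combination h t 0 1
  simp only [neg_eq_zero, mul_eq_zero, OfNat.ofNat_ne_zero, hc, false_or, pow_eq_zero_iff, ne_eq,
    not_false_eq_true] at hpq hrq hpr
  have had : a = 0 ∧ d = 0 := by
    rcases hpr with rfl | rfl
    · exact ⟨by linear_combination hap / 6, by linear_combination hd / 5⟩
    · exact ⟨by linear_combination har, by linear_combination hd / 5⟩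
  have hq : q ≠ 0 := by
    rintro rfl
    exact hv ⟨had.1, by linear_combination hbq / 6, had.2⟩
  exact ⟨had.1, had.2, hpq.resolve_right hq, hrq.resolve_right hq⟩

/-- The binary sextic `X⁶ + XZ⁵` is preserved up to scalars by diagonal matrices only. -/
lemma offdiag_eq_zero_of_binary_sextic {a b c d l : L} (hdet : a * d - b * c ≠ 0)
    (h : ∀ x z : L, (a * x + b * z) ^ 6 + (a * x + b * z) * (c * x + d * z) ^ 5
      = l * (x ^ 6 + x * z ^ 5)) :
    b = 0 ∧ c = 0 ∧ a ^ 6 = l ∧ a * d ^ 5 = l := by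
  obtain ⟨hz6, hz5, -, -, hx4, hx5, hx6⟩ := coeffs_eq_zero_of_forall_eq_zero
    (c₀ := b ^ 6 + b * d ^ 5) (c₁ := 6 * a * b ^ 5 + 5 * b * c * d ^ 4 + a * d ^ 5 - l)
    (c₂ := 15 * a ^ 2 * b ^ 4 + 10 * b * c ^ 2 * d ^ 3 + 5 * a * c * d ^ 4)
    (c₃ := 20 * a ^ 3 * b ^ 3 + 10 * b * c ^ 3 * d ^ 2 + 10 * a * c ^ 2 * d ^ 3)
    (c₄ := 15 * a ^ 4 * b ^ 2 + 5 * b * c ^ 4 * d + 10 * a * c ^ 3 * d ^ 2)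
    (c₅ := 6 * a ^ 5 * b + b * c ^ 5 + 5 * a * c ^ 4 * d)
    (c₆ := a ^ 6 + a * c ^ 5 - l) fun t => by linear_combination h t 1
  have hu : 6 * a ^ 4 * b + c ^ 4 * d = 0 :=
    mul_left_cancel₀ hdet (by linear_combination d * hx5 - 2 / 5 * c * hx4)
  have hv : c ^ 3 * (b * c + 4 * a * d) = 0 :=
    mul_left_cancel₀ hdet (by linear_combination 2 / 5 * a * hx4 - b * hx5)
  have hc : c = 0 := by
    by_contra hc
    have hbc : b * c = -4 * (a * d) := by
      linear_combination (mul_eq_zero.1 hv).resolve_left (pow_ne_zero 3 hc)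
    have had : a * d ≠ 0 := by
      intro h0
      rw [hbc, h0] at hdet
      simp at hdet
    have hc5 : c ^ 5 = 24 * a ^ 5 := by
      refine mul_left_cancel₀ (right_ne_zero_of_mul had) ?_
      linear_combination c * hu - 6 * a ^ 4 * hbc
    have hb : b ≠ 0 := by
      rintro rfl
      apply had
      linear_combination hbc / 4
    have hb5 : b ^ 5 = -d ^ 5 := by
      refine mul_left_cancel₀ hb ?_
      linear_combination hz6
    have h5 : (b * c) ^ 5 = -24 * (a * d) ^ 5 := by
      rw [mul_pow, hb5, hc5]
      ring
    rw [hbc] at h5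
    refine pow_ne_zero 5 had ?_
    linear_combination -h5 / 1000
  subst hc
  have ha : a ≠ 0 := by
    rintro rfl
    simp at hdet
  have hb : b = 0 := by simpa [ha] using hu
  subst hb
  exact ⟨rfl, rfl, by linear_combination hx6, by linear_combination hz5⟩

end Coefficients

section Sextic

variable {L : Type*} [Field L] [CharZero L]

lemma isSmoothSextic_typeThirty :
    IsSmoothSextic (X 0 ^ 6 + X 1 ^ 6 + X 0 * X 2 ^ 5 : MvPolynomial (Fin 3) L) := by
  refine ⟨((isHomogeneous_X_pow _ _).add (isHomogeneous_X_pow _ _)).add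
    ((isHomogeneous_X _ _).mul (isHomogeneous_X_pow _ _)), fun p h h' => ?_⟩
  have h0 := h' 0
  have h1 := h' 1
  have h2 := h' 2
  simp [pderiv_X] at h0 h1 h2
  have hx : p 0 = 0 := by
    rcases h2 with hx | hz
    · exact hx
    · simpa [hz] using h0
  have hz : p 2 = 0 := by simpa [hx] using h0
  ext i
  fin_cases i <;> assumption

omit [CharZero L] in
lemma forall_eval_of_matAct_eq {A : Matrix (Fin 3) (Fin 3) L} {c : L}
    (h : matAct A (X 0 ^ 6 + X 1 ^ 6 + X 0 * X 2 ^ 5) = c • (X 0 ^ 6 + X 1 ^ 6 + X 0 * X 2 ^ 5))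
    (p : Fin 3 → L) :
    A.mulVec p 0 ^ 6 + A.mulVec p 1 ^ 6 + A.mulVec p 0 * A.mulVec p 2 ^ 5
      = c * (p 0 ^ 6 + p 1 ^ 6 + p 0 * p 2 ^ 5) := by
  have h' := congrArg (eval p) h
  simpa [matAct, Matrix.mulVec, dotProduct, mul_add] using h'

omit [CharZero L] in
lemma forall_eval_pderiv_of_matAct_eq {A : Matrix (Fin 3) (Fin 3) L} {c : L}
    (h : matAct A (X 0 ^ 6 + X 1 ^ 6 + X 0 * X 2 ^ 5) = c • (X 0 ^ 6 + X 1 ^ 6 + X 0 * X 2 ^ 5))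
    (p : Fin 3 → L) :
    6 * A.mulVec p 0 ^ 5 * A 0 1 + 6 * A.mulVec p 1 ^ 5 * A 1 1
      + (A 0 1 * A.mulVec p 2 ^ 5 + A.mulVec p 0 * (5 * A.mulVec p 2 ^ 4 * A 2 1))
      = c * (6 * p 1 ^ 5) := by
  have h' := congrArg (fun f => eval p (pderiv 1 f)) h
  simp [matAct, Matrix.mulVec, dotProduct, pderiv_X, Fin.sum_univ_three] at h' ⊢
  linear_combination h'

lemma entries_of_matAct_eq {A : Matrix (Fin 3) (Fin 3) L} (hA : IsUnit A) {c : L} (hc : c ≠ 0)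
    (h : matAct A (X 0 ^ 6 + X 1 ^ 6 + X 0 * X 2 ^ 5) = c • (X 0 ^ 6 + X 1 ^ 6 + X 0 * X 2 ^ 5)) :
    ∃ a u v : L, a ≠ 0 ∧ u ^ 6 = 1 ∧ v ^ 5 = 1 ∧ A = a • !![1, 0, 0; 0, u, 0; 0, 0, v] := by
  obtain ⟨A, rfl⟩ := hA
  set B : Matrix (Fin 3) (Fin 3) L := ↑A⁻¹ with hB
  set M : Matrix (Fin 3) (Fin 3) L := ↑A with hM
  have hMB : M * B = 1 := A.mul_inv
  have hBM : B * M = 1 := A.inv_mul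
  have hd (i j : Fin 3) : B i 0 * M 0 j + B i 1 * M 1 j + B i 2 * M 2 j
      = if i = j then 1 else 0 := by
    have := congrFun (congrFun hBM i) j
    rwa [Matrix.mul_apply, Fin.sum_univ_three, Matrix.one_apply] at this
  obtain ⟨h01, h21, hB0, hB2⟩ := direction_eq_of_derivative_eq_fifth_power (a := M 0 1)
    (b := M 1 1) (d := M 2 1) (p := B 1 0) (q := B 1 1) (r := B 1 2) hc
    (by
      rintro ⟨h0, h1, h2⟩
      simpa [h0, h1, h2] using hd 1 1)
    (fun x y z => by
      have h' := forall_eval_pderiv_of_matAct_eq h (B.mulVec ![x, y, z])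
      rw [Matrix.mulVec_mulVec, hMB, Matrix.one_mulVec] at h'
      simpa [Matrix.mulVec, dotProduct, Fin.sum_univ_three] using h')
  have h11 : B 1 1 * M 1 1 = 1 := by simpa [hB0, hB2] using hd 1 1
  have hB1 : B 1 1 ≠ 0 := left_ne_zero_of_mul_eq_one h11
  have h10 : M 1 0 = 0 := by simpa [hB0, hB2, hB1] using hd 1 0
  have h12 : M 1 2 = 0 := by simpa [hB0, hB2, hB1] using hd 1 2
  have hdet : M 0 0 * M 2 2 - M 0 2 * M 2 0 ≠ 0 := by
    have := (Matrix.isUnit_iff_isUnit_det M).1 A.isUnit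
    rw [Matrix.det_fin_three, h01, h21, h10, h12] at this
    intro h0
    refine this.ne_zero ?_
    linear_combination M 1 1 * h0
  have hF := forall_eval_of_matAct_eq h
  simp only [Matrix.mulVec, dotProduct, Fin.sum_univ_three, h01, h21, h10, h12] at hF
  obtain ⟨h02, h20, h00, h22⟩ := offdiag_eq_zero_of_binary_sextic (l := c) hdet fun x z => by
    simpa using hF ![x, 0, z]
  have he : M 1 1 ^ 6 = c := by simpa using hF ![0, 1, 0]
  have ha : M 0 0 ≠ 0 := by
    rintro h0
    simp [h0, h02] at hdet
  refine ⟨M 0 0, M 1 1 / M 0 0, M 2 2 / M 0 0, ha, ?_, ?_, ?_⟩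
  · rw [div_pow, he, h00, div_self hc]
  · rw [div_pow, div_eq_one_iff_eq (pow_ne_zero 5 ha)]
    refine mul_left_cancel₀ ha ?_
    linear_combination h22 - h00
  · ext i j
    fin_cases i <;> fin_cases j <;> simp [h01, h21, h10, h12, h02, h20] <;> field_simp

omit [CharZero L] in
lemma matAct_diagonal_typeThirty {u v : L} (hu : u ^ 6 = 1) (hv : v ^ 5 = 1) :
    matAct !![1, 0, 0; 0, u, 0; 0, 0, v] (X 0 ^ 6 + X 1 ^ 6 + X 0 * X 2 ^ 5)
      = (1 : L) • (X 0 ^ 6 + X 1 ^ 6 + X 0 * X 2 ^ 5) := by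
  simp [matAct, Fin.sum_univ_three, mul_pow, ← C_pow, hu, hv]

end Sextic

section Projective

variable {L : Type*} [Field L]

lemma pgl_coe (A : GL3 L) : pgl (A : Matrix (Fin 3) (Fin 3) L) = (QuotientGroup.mk A : PGL3 L) := by
  simp [pgl]

lemma pgl_smul {A : Matrix (Fin 3) (Fin 3) L} (hA : IsUnit A) {a : L} (ha : a ≠ 0) :
    pgl (a • A) = pgl A := by
  obtain ⟨A, rfl⟩ := hA
  let Z : GL3 L := Units.map (Matrix.scalar (Fin 3)).toMonoidHom (Units.mk0 a ha)
  have hZ : Z ∈ Subgroup.center (GL3 L) :=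
    Matrix.GeneralLinearGroup.mem_center_iff_val_mem_range_scalar.2 ⟨a, rfl⟩
  have hAZ : a • (A : Matrix (Fin 3) (Fin 3) L) = ((A * Z : GL3 L) : Matrix _ _ L) := by
    ext i j
    simp [Z, mul_comm]
  rw [hAZ, pgl_coe, pgl_coe, QuotientGroup.mk_mul_of_mem A hZ]

lemma pgl_pow {A : Matrix (Fin 3) (Fin 3) L} (hA : IsUnit A) (n : ℕ) :
    pgl A ^ n = pgl (A ^ n) := by
  obtain ⟨A, rfl⟩ := hA
  rw [← Units.val_pow_eq_pow_val, pgl_coe, pgl_coe, QuotientGroup.mk_pow]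

lemma isUnit_diagonal {u v : L} (hu : u ≠ 0) (hv : v ≠ 0) :
    IsUnit !![1, 0, 0; 0, u, 0; 0, 0, v] := by
  rw [Matrix.isUnit_iff_isUnit_det, Matrix.det_fin_three]
  simp [hu, hv]

lemma diagonal_pow (u v : L) (n : ℕ) :
    !![1, 0, 0; 0, u, 0; 0, 0, v] ^ n = !![1, 0, 0; 0, u ^ n, 0; 0, 0, v ^ n] := by
  induction n with
  | zero => simp [Matrix.one_fin_three]
  | succ n ih => simp [pow_succ, ih]

lemma pgl_diagonal_eq_one_iff {u v : L} (hu : u ≠ 0) (hv : v ≠ 0) :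
    pgl !![1, 0, 0; 0, u, 0; 0, 0, v] = 1 ↔ u = 1 ∧ v = 1 := by
  obtain ⟨A, hA⟩ := isUnit_diagonal hu hv
  rw [← hA, pgl_coe, QuotientGroup.eq_one_iff,
    Matrix.GeneralLinearGroup.mem_center_iff_val_mem_range_scalar, hA]
  constructor
  · rintro ⟨a, ha⟩
    have h0 := congrFun (congrFun ha 0) 0
    have h1 := congrFun (congrFun ha 1) 1
    have h2 := congrFun (congrFun ha 2) 2
    simp at h0 h1 h2
    exact ⟨h1.symm.trans h0, h2.symm.trans h0⟩
  · rintro ⟨rfl, rfl⟩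
    exact ⟨1, by simp [Matrix.one_fin_three]⟩

end Projective

lemma exists_pow_eq_of_isPrimitiveRoot_thirty {L : Type*} [Field L] {ζ u v : L}
    (hζ : IsPrimitiveRoot ζ 30) (hu : u ^ 6 = 1) (hv : v ^ 5 = 1) :
    ∃ n : ℕ, (ζ ^ 5) ^ n = u ∧ (ζ ^ 6) ^ n = v := by
  have h5 : IsPrimitiveRoot (ζ ^ 5) 6 := hζ.pow (by norm_num) (by norm_num)
  have h6 : IsPrimitiveRoot (ζ ^ 6) 5 := hζ.pow (by norm_num) (by norm_num)
  obtain ⟨i, -, rfl⟩ := h5.eq_pow_of_pow_eq_one hu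
  obtain ⟨j, -, rfl⟩ := h6.eq_pow_of_pow_eq_one hv
  obtain ⟨n, hi, hj⟩ : ∃ n, n ≡ i [MOD 6] ∧ n ≡ j [MOD 5] :=
    ⟨_, (Nat.chineseRemainder (by norm_num) i j).2⟩
  refine ⟨n, ?_, ?_⟩
  · rw [pow_eq_pow_mod n h5.pow_eq_one, pow_eq_pow_mod i h5.pow_eq_one, hi]
  · rw [pow_eq_pow_mod n h6.pow_eq_one, pow_eq_pow_mod j h6.pow_eq_one, hj]

/-- The sextic `X⁶ + Y⁶ + XZ⁵` is smooth and its automorphism group is cyclic of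
order `30`, generated by `diag(1, ζ₃₀⁵, ζ₃₀⁶)`. -/
theorem typeThirty_sextic_automorphisms {K : Type*} [Field K] [IsAlgClosed K] [CharZero K]
    (ζ : K) (hζ : IsPrimitiveRoot ζ 30) :
    IsSmoothSextic (X 0 ^ 6 + X 1 ^ 6 + X 0 * X 2 ^ 5 : MvPolynomial (Fin 3) K) ∧
    planeAut (X 0 ^ 6 + X 1 ^ 6 + X 0 * X 2 ^ 5 : MvPolynomial (Fin 3) K)
      = Subgroup.zpowers (pgl !![1, 0, 0; 0, ζ ^ 5, 0; 0, 0, ζ ^ 6]) ∧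
    Nat.card ↥(planeAut (X 0 ^ 6 + X 1 ^ 6 + X 0 * X 2 ^ 5 : MvPolynomial (Fin 3) K)) = 30 := by
  have h0 : ζ ≠ 0 := hζ.ne_zero (by norm_num)
  have h30 := hζ.pow_eq_one
  have hU := isUnit_diagonal (pow_ne_zero 5 h0) (pow_ne_zero 6 h0)
  have hAut : planeAut (X 0 ^ 6 + X 1 ^ 6 + X 0 * X 2 ^ 5 : MvPolynomial (Fin 3) K)
      = Subgroup.zpowers (pgl !![1, 0, 0; 0, ζ ^ 5, 0; 0, 0, ζ ^ 6]) := by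
    refine le_antisymm ?_ ((Subgroup.zpowers_le).2 ?_)
    · rintro _ ⟨A, rfl, c, hc, hA⟩
      obtain ⟨a, u, v, ha, hu, hv, hAe⟩ := entries_of_matAct_eq A.isUnit hc hA
      obtain ⟨n, rfl, rfl⟩ := exists_pow_eq_of_isPrimitiveRoot_thirty hζ hu hv
      rw [← diagonal_pow] at hAe
      refine ⟨n, ?_⟩
      change pgl _ ^ (n : ℤ) = _
      rw [← pgl_coe A, hAe, pgl_smul (hU.pow n) ha, zpow_natCast, pgl_pow hU]
    · obtain ⟨A, hA⟩ := hU
      refine ⟨A, by rw [← hA, pgl_coe], 1, one_ne_zero, ?_⟩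
      rw [hA]
      exact matAct_diagonal_typeThirty (by rw [← pow_mul, h30]) (by rw [← pow_mul, h30])
  refine ⟨isSmoothSextic_typeThirty, hAut, ?_⟩
  rw [hAut, Nat.card_zpowers, hζ.eq_orderOf, orderOf_eq_orderOf_iff]
  intro n
  rw [pgl_pow hU, diagonal_pow,
    pgl_diagonal_eq_one_iff (pow_ne_zero n (pow_ne_zero 5 h0)) (pow_ne_zero n (pow_ne_zero 6 h0)),
    ← pow_mul, ← pow_mul, mul_comm 5, mul_comm 6, pow_mul, pow_mul]
  constructor
  · rintro ⟨h5, h6⟩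
    rwa [pow_succ, h5, one_mul] at h6
  · intro h
    simp [h]
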